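/- Let v : S¹ → ℂ be continuous with |v(z)| = 1 for all z ∈ S¹. Then there exists T ≥ 1 such that for all t ≥ T, the real number 1/2 does not belong to the spectrum of the self-adjoint bounded operator e(u_t, M_v) on L²(S¹) ⊕ L²(S¹). -/

import Mathlib

open Complex Real Filter MeasureTheory AddCircle ContinuousLinearMap

instance : Fact ((0 : ℝ) < 1) := ⟨one_pos⟩

/-- `L²(S¹)`, realized as the `L²` space of the circle `ℝ/ℤ` with its normalized Haar
measure; the Fourier orthonormal basis is `(fourierLp 2 n)_{n ∈ ℤ}`. -/
noncomputable abbrev L2Circle : Type := Lp ℂ 2 (@haarAddCircle 1 _)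

/-- The block operator `[[A, B], [C, D]]` on `L²(S¹) ⊕ L²(S¹)`. -/
noncomputable def blockOp (A B C D : L2Circle →L[ℂ] L2Circle) :
    WithLp 2 (L2Circle × L2Circle) →L[ℂ] WithLp 2 (L2Circle × L2Circle) :=
  (WithLp.prodContinuousLinearEquiv 2 ℂ L2Circle L2Circle).symm.toContinuousLinearMap ∘L
    (((A ∘L fst ℂ L2Circle L2Circle) + (B ∘L snd ℂ L2Circle L2Circle)).prod
      ((C ∘L fst ℂ L2Circle L2Circle) + (D ∘L snd ℂ L2Circle L2Circle))) ∘L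
    (WithLp.prodContinuousLinearEquiv 2 ℂ L2Circle L2Circle).toContinuousLinearMap

/-- The Loring element `e(u_t, M_v)` of the pair of unitaries `(u_t, M_v)`. -/
noncomputable def loringOp (f g h : ℂ → ℝ) (Ut M : L2Circle →L[ℂ] L2Circle) :
    WithLp 2 (L2Circle × L2Circle) →L[ℂ] WithLp 2 (L2Circle × L2Circle) :=
  blockOp (cfc (fun z : ℂ => (f z : ℂ)) Ut)
    (cfc (fun z : ℂ => (g z : ℂ)) Ut + cfc (fun z : ℂ => (h z : ℂ)) Ut * M)
    (star M * cfc (fun z : ℂ => (h z : ℂ)) Ut + cfc (fun z : ℂ => (g z : ℂ)) Ut)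
    (1 - cfc (fun z : ℂ => (f z : ℂ)) Ut)

section Commutators

variable {A : Type*} [CStarAlgebra A]

/-- Elements of the unit ball which almost commute with a normal element `a` and its adjoint
almost commute with `φ(a)`, uniformly over all normal `a` with spectrum in a fixed compact set. -/
theorem exists_commutator_cfcHomSuperset_le {s : Set ℂ} [CompactSpace s] (φ : C(s, ℂ)) :
    ∀ ε > 0, ∃ δ > 0, ∀ (a x : A) (ha : IsStarNormal a) (hs : spectrum ℂ a ⊆ s), ‖x‖ ≤ 1 →
      ‖a * x - x * a‖ ≤ δ → ‖star a * x - x * star a‖ ≤ δ →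
      ‖cfcHomSuperset ha hs φ * x - x * cfcHomSuperset ha hs φ‖ ≤ ε := by
  have norm_le (a : A) (ha : IsStarNormal a) (hs : spectrum ℂ a ⊆ s) (ψ : C(s, ℂ)) :
      ‖cfcHomSuperset ha hs ψ‖ ≤ ‖ψ‖ := NonUnitalStarAlgHom.norm_apply_le _ _
  induction φ using ContinuousMap.induction_on_of_compact with
  | const r =>
    intro ε hε
    refine ⟨1, one_pos, fun a x ha hs _ _ _ ↦ ?_⟩
    have : ContinuousMap.const s r = algebraMap ℂ C(s, ℂ) r := rfl
    rw [this, AlgHomClass.commutes, Algebra.commutes, sub_self, norm_zero]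
    exact hε.le
  | id =>
    intro ε hε
    refine ⟨ε, hε, fun a x ha hs _ h _ ↦ ?_⟩
    rwa [cfcHomSuperset_id]
  | star_id =>
    intro ε hε
    refine ⟨ε, hε, fun a x ha hs _ _ h ↦ ?_⟩
    rwa [map_star, cfcHomSuperset_id]
  | add φ ψ hφ hψ =>
    intro ε hε
    obtain ⟨δ₁, h₁, H₁⟩ := hφ (ε / 2) (half_pos hε)
    obtain ⟨δ₂, h₂, H₂⟩ := hψ (ε / 2) (half_pos hε)
    refine ⟨min δ₁ δ₂, lt_min h₁ h₂, fun a x ha hs hx h h' ↦ ?_⟩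
    have k₁ := H₁ a x ha hs hx (h.trans (min_le_left _ _)) (h'.trans (min_le_left _ _))
    have k₂ := H₂ a x ha hs hx (h.trans (min_le_right _ _)) (h'.trans (min_le_right _ _))
    rw [map_add, add_mul, mul_add, add_sub_add_comm]
    linarith [norm_add_le_of_le k₁ k₂]
  | mul φ ψ hφ hψ =>
    intro ε hε
    obtain ⟨δ₁, h₁, H₁⟩ := hφ (ε / 2 / (‖ψ‖ + 1)) (by positivity)
    obtain ⟨δ₂, h₂, H₂⟩ := hψ (ε / 2 / (‖φ‖ + 1)) (by positivity)
    refine ⟨min δ₁ δ₂, lt_min h₁ h₂, fun a x ha hs hx h h' ↦ ?_⟩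
    have k₁ := H₁ a x ha hs hx (h.trans (min_le_left _ _)) (h'.trans (min_le_left _ _))
    have k₂ := H₂ a x ha hs hx (h.trans (min_le_right _ _)) (h'.trans (min_le_right _ _))
    have n₁ := norm_le a ha hs φ
    have n₂ := norm_le a ha hs ψ
    rw [map_mul]
    set p := cfcHomSuperset ha hs φ
    set q := cfcHomSuperset ha hs ψ
    have key : p * q * x - x * (p * q) = p * (q * x - x * q) + (p * x - x * p) * q := by
      noncomm_ring
    rw [key]
    calc ‖p * (q * x - x * q) + (p * x - x * p) * q‖
        ≤ ‖p‖ * ‖q * x - x * q‖ + ‖p * x - x * p‖ * ‖q‖ :=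
          norm_add_le_of_le (norm_mul_le _ _) (norm_mul_le _ _)
      _ ≤ (‖φ‖ + 1) * (ε / 2 / (‖φ‖ + 1)) + (ε / 2 / (‖ψ‖ + 1)) * (‖ψ‖ + 1) := by
          gcongr <;> linarith
      _ = ε := by field_simp; ring
  | frequently φ hφ =>
    intro ε hε
    obtain ⟨ψ, hψ, H⟩ :=
      Filter.frequently_iff.mp hφ (Metric.closedBall_mem_nhds φ (by positivity : 0 < ε / 4))
    obtain ⟨δ, hδ, H⟩ := H (ε / 2) (half_pos hε)
    refine ⟨δ, hδ, fun a x ha hs hx h h' ↦ ?_⟩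
    have k := H a x ha hs hx h h'
    rw [Metric.mem_closedBall, dist_comm, dist_eq_norm] at hψ
    have n := (norm_le a ha hs (φ - ψ)).trans hψ
    rw [map_sub] at n
    set p := cfcHomSuperset ha hs φ
    set q := cfcHomSuperset ha hs ψ
    have key : p * x - x * p = (p - q) * x - x * (p - q) + (q * x - x * q) := by noncomm_ring
    rw [key]
    calc ‖(p - q) * x - x * (p - q) + (q * x - x * q)‖
        ≤ ‖p - q‖ * ‖x‖ + ‖x‖ * ‖p - q‖ + ‖q * x - x * q‖ :=
          norm_add_le_of_le (norm_sub_le_of_le (norm_mul_le _ _) (norm_mul_le _ _)) le_rfl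
      _ ≤ ε / 4 * 1 + 1 * (ε / 4) + ε / 2 := by gcongr
      _ = ε := by ring

/-- The commutator of a unitary with an element has the same norm as that of its adjoint. -/
theorem norm_star_commutator_of_mem_unitary {u : A} (hu : u ∈ unitary A) (x : A) :
    ‖star u * x - x * star u‖ = ‖u * x - x * u‖ := by
  have key : star u * x - x * star u = -(star u * (u * x - x * u) * star u) := by
    have h₁ := Unitary.star_mul_self_of_mem hu
    have h₂ := Unitary.mul_star_self_of_mem hu
    calc star u * x - x * star u
        = -((star u * u) * x * star u - star u * x * (u * star u)) := by rw [h₁, h₂]; noncomm_ring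
      _ = _ := by noncomm_ring
  rw [key, norm_neg, CStarRing.norm_mul_mem_unitary _ (Unitary.star_mem hu),
    CStarRing.norm_mem_unitary_mul _ (Unitary.star_mem hu)]

/-- Contractions which almost commute with a unitary almost commute with its continuous
functional calculus. -/
theorem exists_commutator_cfc_le {φ : ℂ → ℂ} (hφ : ContinuousOn φ (Metric.sphere (0 : ℂ) 1))
    {ε : ℝ} (hε : 0 < ε) :
    ∃ δ > 0, ∀ u ∈ unitary A, ∀ x : A, ‖x‖ ≤ 1 → ‖u * x - x * u‖ ≤ δ →
      ‖cfc φ u * x - x * cfc φ u‖ ≤ ε := by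
  have : CompactSpace (Metric.sphere (0 : ℂ) 1) :=
    isCompact_iff_compactSpace.mp (isCompact_sphere _ _)
  obtain ⟨δ, hδ, H⟩ := exists_commutator_cfcHomSuperset_le (A := A) ⟨_, hφ.domRestrict⟩ ε hε
  refine ⟨δ, hδ, fun u hu x hx h ↦ ?_⟩
  have hn : IsStarNormal u := isStarNormal_of_mem_unitary hu
  have hs : spectrum ℂ u ⊆ Metric.sphere 0 1 := spectrum.subset_circle_of_unitary hu
  have := H u x hn hs hx h ((norm_star_commutator_of_mem_unitary hu x).trans_le h)
  rw [cfc_apply _ _ hn (hφ.mono hs)]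
  exact this

end Commutators

section DiagonalOperators

variable {ι H : Type*} [NormedAddCommGroup H] [InnerProductSpace ℂ H]

theorem HilbertBasis.hasSum_norm_sq_repr (b : HilbertBasis ι ℂ H) (x : H) :
    HasSum (fun i ↦ ‖b.repr x i‖ ^ 2) (‖x‖ ^ 2) := by
  rw [← b.repr.norm_map x]
  exact_mod_cast lp.hasSum_norm (p := 2) (by simp) (b.repr x)

theorem HilbertBasis.clm_ext (b : HilbertBasis ι ℂ H) {F : Type*} [NormedAddCommGroup F]
    [NormedSpace ℂ F] {S T : H →L[ℂ] F} (h : ∀ i, S (b i) = T (b i)) : S = T := by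
  refine ContinuousLinearMap.ext_on (s := Set.range b) ?_ (by rintro _ ⟨i, rfl⟩; exact h i)
  rw [Submodule.dense_iff_topologicalClosure_eq_top]
  exact b.dense_span

/-- A weighted permutation of a Hilbert basis with weights bounded by `C` has norm at most `C`. -/
theorem HilbertBasis.opNorm_le_of_weighted_perm (b : HilbertBasis ι ℂ H) (σ : Equiv.Perm ι)
    {c : ι → ℂ} {C : ℝ} (hC : 0 ≤ C) (hc : ∀ i, ‖c i‖ ≤ C) {W : H →L[ℂ] H}
    (hW : ∀ i, W (b i) = c i • b (σ i)) : ‖W‖ ≤ C := by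
  classical
  have coord (x : H) (i : ι) : b.repr (W x) (σ i) = c i * b.repr x i := by
    have : (innerSL ℂ (b (σ i))) ∘L W = c i • innerSL ℂ (b i) := by
      refine b.clm_ext fun j ↦ ?_
      simp [hW, orthonormal_iff_ite.mp b.orthonormal]
      grind
    simpa [b.repr_apply_apply] using DFunLike.congr_fun this x
  refine W.opNorm_le_bound hC fun x ↦ ?_
  refine (sq_le_sq₀ (by positivity) (by positivity)).mp ?_
  rw [mul_pow]
  refine hasSum_le (fun i ↦ ?_) ((Equiv.hasSum_iff σ).mpr (b.hasSum_norm_sq_repr (W x)))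
    ((b.hasSum_norm_sq_repr x).mul_left (C ^ 2))
  simp only [Function.comp_apply]
  rw [coord, norm_mul, mul_pow]
  gcongr
  exact hc i

variable [CompleteSpace H]

theorem HilbertBasis.adjoint_apply_of_diagonal (b : HilbertBasis ι ℂ H) {d : ι → ℂ}
    {D : H →L[ℂ] H} (hD : ∀ i, D (b i) = d i • b i) (i : ι) :
    adjoint D (b i) = star (d i) • b i := by
  classical
  refine b.repr.injective (lp.ext (funext fun j ↦ ?_))
  rw [b.repr_apply_apply, b.repr_apply_apply, adjoint_inner_right, hD, inner_smul_left,
    inner_smul_right, orthonormal_iff_ite.mp b.orthonormal]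
  split_ifs with h <;> simp [h]

/-- An operator which is diagonal in a Hilbert basis with unimodular entries is unitary. -/
theorem HilbertBasis.mem_unitary_of_diagonal (b : HilbertBasis ι ℂ H) {d : ι → ℂ}
    (hd : ∀ i, ‖d i‖ = 1) {D : H →L[ℂ] H} (hD : ∀ i, D (b i) = d i • b i) :
    D ∈ unitary (H →L[ℂ] H) := by
  have hd' (i) : star (d i) * d i = 1 := by
    simpa [hd i] using Complex.conj_mul' (d i)
  rw [Unitary.mem_iff, star_eq_adjoint]
  constructor <;> refine b.clm_ext fun i ↦ ?_
  · rw [mul_def, comp_apply, hD, map_smul, b.adjoint_apply_of_diagonal hD, smul_smul, mul_comm,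
      hd' i]
    simp
  · rw [mul_def, comp_apply, b.adjoint_apply_of_diagonal hD, map_smul, hD, smul_smul, hd' i]
    simp

end DiagonalOperators

section MultiplicationOperators

/-- Multiplication by a continuous function, as an operator on `L²(S¹)`. -/
noncomputable def mulOp : C(AddCircle (1 : ℝ), ℂ) →L[ℂ] (L2Circle →L[ℂ] L2Circle) :=
  ((ContinuousLinearMap.mul ℂ ℂ).holderL (@haarAddCircle 1 _) ⊤ 2 2) ∘L
    ContinuousMap.toLp (E := ℂ) ⊤ (@haarAddCircle 1 _) ℂ

theorem mulOp_apply_ae (w : C(AddCircle (1 : ℝ), ℂ)) (ξ : L2Circle) :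
    ⇑(mulOp w ξ) =ᵐ[@haarAddCircle 1 _] fun x ↦ w x * ξ x := by
  have h : mulOp w ξ = (ContinuousLinearMap.mul ℂ ℂ).holder 2
    (ContinuousMap.toLp (E := ℂ) ⊤ (@haarAddCircle 1 _) ℂ w) ξ := rfl
  rw [h]
  filter_upwards [(ContinuousLinearMap.mul ℂ ℂ).coeFn_holder (r := 2)
    (ContinuousMap.toLp (E := ℂ) ⊤ (@haarAddCircle 1 _) ℂ w) ξ,
    ContinuousMap.coeFn_toLp (p := ⊤) (𝕜 := ℂ) (@haarAddCircle 1 _) w] with x h₁ h₂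
  rw [h₁, h₂]
  rfl

theorem eq_mulOp_of_ae {w : C(AddCircle (1 : ℝ), ℂ)} {M : L2Circle →L[ℂ] L2Circle}
    (hM : ∀ ξ : L2Circle, ⇑(M ξ) =ᵐ[@haarAddCircle 1 _] fun x ↦ w x * ξ x) : M = mulOp w :=
  ContinuousLinearMap.ext fun ξ ↦ Lp.ext ((hM ξ).trans (mulOp_apply_ae w ξ).symm)

theorem mulOp_one : mulOp 1 = 1 :=
  (eq_mulOp_of_ae fun ξ ↦ by simp).symm

theorem mulOp_mul (w₁ w₂ : C(AddCircle (1 : ℝ), ℂ)) :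
    mulOp (w₁ * w₂) = mulOp w₁ * mulOp w₂ := by
  refine (eq_mulOp_of_ae fun ξ ↦ ?_).symm
  filter_upwards [mulOp_apply_ae w₁ (mulOp w₂ ξ), mulOp_apply_ae w₂ ξ] with x h₁ h₂
  rw [mul_def, comp_apply, h₁, h₂, ContinuousMap.mul_apply, mul_assoc]

theorem star_mulOp (w : C(AddCircle (1 : ℝ), ℂ)) : star (mulOp w) = mulOp (star w) := by
  rw [star_eq_adjoint, eq_comm, eq_adjoint_iff]
  intro ξ η
  rw [L2.inner_def, L2.inner_def]
  refine integral_congr_ae ?_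
  filter_upwards [mulOp_apply_ae (star w) ξ, mulOp_apply_ae w η] with x h₁ h₂
  rw [h₁, h₂]
  simp
  ring

theorem mulOp_mem_unitary {w : C(AddCircle (1 : ℝ), ℂ)} (hw : ∀ x, ‖w x‖ = 1) :
    mulOp w ∈ unitary (L2Circle →L[ℂ] L2Circle) := by
  have h : star w * w = 1 := by
    ext x
    simpa [hw x] using Complex.conj_mul' (w x)
  rw [Unitary.mem_iff, star_mulOp, ← mulOp_mul, ← mulOp_mul, mul_comm w, h, mulOp_one]
  exact ⟨rfl, rfl⟩

theorem mulOp_fourier_apply (k n : ℤ) :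
    mulOp (fourier k) (fourierLp 2 n) = fourierLp 2 (n + k) := by
  refine Lp.ext ?_
  filter_upwards [mulOp_apply_ae (fourier k) (fourierLp 2 n), coeFn_fourierLp 2 n,
    coeFn_fourierLp (T := 1) 2 (n + k)] with x h₁ h₂ h₃
  rw [h₁, h₂, h₃, fourier_add, mul_comm]

end MultiplicationOperators

section DiagonalUnitaries

theorem norm_le_one_of_mem_unitary {u : L2Circle →L[ℂ] L2Circle}
    (hu : u ∈ unitary (L2Circle →L[ℂ] L2Circle)) : ‖u‖ ≤ 1 := by
  rw [← mul_one u, CStarRing.norm_mem_unitary_mul _ hu]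
  exact norm_id_le

/-- The `n`-th diagonal entry of `u_t`. -/
noncomputable def diagEntry (t : ℝ) (n : ℤ) : ℂ :=
  if 0 ≤ n ∧ (n : ℝ) ≤ t then Complex.exp (2 * Real.pi * Complex.I * n / t) else 1

theorem diagEntry_eq_exp {t : ℝ} (ht : 0 < t) (n : ℤ) :
    diagEntry t n = Complex.exp (Complex.I * (2 * Real.pi / t * max 0 (min (n : ℝ) t) : ℝ)) := by
  have ht' : (t : ℂ) ≠ 0 := by exact_mod_cast ht.ne'
  unfold diagEntry
  split_ifs with h
  · have h0 : (0 : ℝ) ≤ n := by exact_mod_cast h.1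
    rw [min_eq_left h.2, max_eq_right h0]
    congr 1
    push_cast
    ring
  · by_cases h0 : 0 ≤ n
    · have h1 : t ≤ n := by
        by_contra! h1
        exact h ⟨h0, h1.le⟩
      rw [min_eq_right h1, max_eq_right ht.le, div_mul_cancel₀ _ ht.ne']
      push_cast
      rw [mul_comm, Complex.exp_two_pi_mul_I]
    · have h1 : (n : ℝ) ≤ 0 := by exact_mod_cast (not_le.mp h0).le
      rw [max_eq_left ((min_le_left _ _).trans h1)]
      simp

theorem norm_diagEntry {t : ℝ} (ht : 0 < t) (n : ℤ) : ‖diagEntry t n‖ = 1 := by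
  rw [diagEntry_eq_exp ht, Complex.norm_exp_I_mul_ofReal]

theorem norm_diagEntry_sub_le {t : ℝ} (ht : 0 < t) (m n : ℤ) :
    ‖diagEntry t m - diagEntry t n‖ ≤ 2 * Real.pi / t * |(m : ℝ) - n| := by
  have lip (a b : ℝ) :
      ‖Complex.exp (Complex.I * a) - Complex.exp (Complex.I * b)‖ ≤ |a - b| := by
    have : Complex.exp (Complex.I * a) - Complex.exp (Complex.I * b) =
        Complex.exp (Complex.I * b) * (Complex.exp (Complex.I * (a - b : ℝ)) - 1) := by
      rw [mul_sub, ← Complex.exp_add, mul_one]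
      congr 2
      push_cast
      ring
    rw [this, norm_mul, Complex.norm_exp_I_mul_ofReal, one_mul]
    exact Real.norm_exp_I_mul_ofReal_sub_one_le
  rw [diagEntry_eq_exp ht, diagEntry_eq_exp ht]
  refine (lip _ _).trans ?_
  rw [← mul_sub, abs_mul, abs_of_pos (by positivity : 0 < 2 * Real.pi / t)]
  refine mul_le_mul_of_nonneg_left ?_ (by positivity)
  calc |max 0 (min (m : ℝ) t) - max 0 (min (n : ℝ) t)|
      ≤ |min (m : ℝ) t - min (n : ℝ) t| := by
        simpa [max_comm] using abs_max_sub_max_le_abs (min (m : ℝ) t) (min (n : ℝ) t) 0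
    _ ≤ |(m : ℝ) - n| := by
        simpa using abs_min_sub_min_le_max (m : ℝ) t n t

theorem norm_commutator_fourier_le
    {t : ℝ} (ht : 0 < t) {u : L2Circle →L[ℂ] L2Circle}
    (hu : ∀ n : ℤ, u (fourierLp 2 n) = diagEntry t n • fourierLp 2 n) (k : ℤ) :
    ‖u * mulOp (fourier k) - mulOp (fourier k) * u‖ ≤ 2 * Real.pi / t * |(k : ℝ)| := by
  refine (fourierBasis (T := 1)).opNorm_le_of_weighted_perm (Equiv.addRight k)
    (c := fun n ↦ diagEntry t (n + k) - diagEntry t n) (by positivity) (fun n ↦ ?_) (fun n ↦ ?_)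
  · simpa using norm_diagEntry_sub_le ht (n + k) n
  · rw [coe_fourierBasis, sub_apply, mul_def, comp_apply, mul_def, comp_apply, hu, map_smul,
      mulOp_fourier_apply, hu, ← sub_smul, Equiv.coe_addRight]

theorem mem_unitary_of_diagEntry {t : ℝ} (ht : 0 < t) {u : L2Circle →L[ℂ] L2Circle}
    (hu : ∀ n : ℤ, u (fourierLp 2 n) = diagEntry t n • fourierLp 2 n) :
    u ∈ unitary (L2Circle →L[ℂ] L2Circle) :=
  (fourierBasis (T := 1)).mem_unitary_of_diagonal (norm_diagEntry ht) (by simpa using hu)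

/-- The diagonal unitaries asymptotically commute with multiplication operators. -/
theorem tendsto_commutator_mulOp {U : ℝ → (L2Circle →L[ℂ] L2Circle)}
    (hU : ∀ t : ℝ, 1 ≤ t → ∀ n : ℤ, U t (fourierLp 2 n) = diagEntry t n • fourierLp 2 n)
    (w : C(AddCircle (1 : ℝ), ℂ)) :
    Tendsto (fun t ↦ U t * mulOp w - mulOp w * U t) atTop (nhds 0) := by
  have hspan : ∀ p ∈ Submodule.span ℂ (Set.range (@fourier 1)),
      Tendsto (fun t ↦ U t * mulOp p - mulOp p * U t) atTop (nhds 0) := by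
    intro p hp
    induction hp using Submodule.span_induction with
    | mem p hp =>
      obtain ⟨k, rfl⟩ := hp
      have hlim : Tendsto (fun t : ℝ ↦ 2 * Real.pi / t * |(k : ℝ)|) atTop (nhds 0) := by
        simpa using (tendsto_const_nhds.div_atTop tendsto_id).mul_const |(k : ℝ)|
      refine squeeze_zero_norm' ?_ hlim
      filter_upwards [eventually_ge_atTop 1] with t ht
      exact norm_commutator_fourier_le (by linarith) (hU t ht) k
    | zero => simp
    | add p q _ _ hp hq =>
      simpa [mul_add, add_mul, add_sub_add_comm] using hp.add hq
    | smul c p _ hp =>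
      simpa [smul_sub] using hp.const_smul c
  rw [Metric.tendsto_nhds]
  intro ε hε
  have hw : w ∈ (Submodule.span ℂ (Set.range (@fourier 1))).topologicalClosure := by
    rw [span_fourier_closure_eq_top]
    trivial
  obtain ⟨p, hp, hwp⟩ := Metric.mem_closure_iff.mp hw (ε / (4 * (‖mulOp‖ + 1))) (by positivity)
  filter_upwards [Metric.tendsto_nhds.mp (hspan p hp) (ε / 2) (half_pos hε),
    eventually_ge_atTop 1] with t h ht
  have hu : ‖U t‖ ≤ 1 :=
    norm_le_one_of_mem_unitary (mem_unitary_of_diagEntry (by linarith) (hU t ht))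
  have hd : ‖mulOp (w - p)‖ ≤ ε / 4 := by
    rw [dist_eq_norm] at hwp
    calc ‖mulOp (w - p)‖ ≤ (‖mulOp‖ + 1) * (ε / (4 * (‖mulOp‖ + 1))) :=
          (mulOp.le_opNorm _).trans (by gcongr; linarith)
      _ = ε / 4 := by field_simp
  rw [dist_zero_right] at h ⊢
  have key : U t * mulOp w - mulOp w * U t =
      U t * mulOp (w - p) - mulOp (w - p) * U t + (U t * mulOp p - mulOp p * U t) := by
    rw [map_sub]
    noncomm_ring
  rw [key]
  calc _ ≤ ‖U t‖ * ‖mulOp (w - p)‖ + ‖mulOp (w - p)‖ * ‖U t‖ +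
        ‖U t * mulOp p - mulOp p * U t‖ :=
          norm_add_le_of_le (norm_sub_le_of_le (norm_mul_le _ _) (norm_mul_le _ _)) le_rfl
    _ ≤ 1 * (ε / 4) + ε / 4 * 1 + ‖U t * mulOp p - mulOp p * U t‖ := by gcongr
    _ < ε := by linarith

end DiagonalUnitaries

section BlockOperators

theorem blockOp_apply (A B C D : L2Circle →L[ℂ] L2Circle) (x : WithLp 2 (L2Circle × L2Circle)) :
    blockOp A B C D x = WithLp.toLp 2 (A x.fst + B x.snd, C x.fst + D x.snd) := rfl

theorem blockOp_mul (A B C D A' B' C' D' : L2Circle →L[ℂ] L2Circle) :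
    blockOp A B C D * blockOp A' B' C' D' =
      blockOp (A * A' + B * C') (A * B' + B * D') (C * A' + D * C') (C * B' + D * D') := by
  ext1 x
  simp only [mul_def, comp_apply, blockOp_apply, map_add, add_apply, WithLp.toLp_fst,
    WithLp.toLp_snd]
  congr 2 <;> abel

theorem blockOp_sub (A B C D A' B' C' D' : L2Circle →L[ℂ] L2Circle) :
    blockOp A B C D - blockOp A' B' C' D' = blockOp (A - A') (B - B') (C - C') (D - D') := by
  ext1 x
  simp only [blockOp_apply, sub_apply, ← WithLp.toLp_sub, Prod.mk_sub_mk]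
  congr 2 <;> abel

theorem norm_blockOp_le (A B C D : L2Circle →L[ℂ] L2Circle) :
    ‖blockOp A B C D‖ ≤ ‖A‖ + ‖B‖ + ‖C‖ + ‖D‖ := by
  refine opNorm_le_bound _ (by positivity) fun x ↦ ?_
  have h₁ : ‖x.fst‖ ≤ ‖x‖ := WithLp.norm_fst_le _ x
  have h₂ : ‖x.snd‖ ≤ ‖x‖ := WithLp.norm_snd_le _ x
  have tri (a b : L2Circle) :
      ‖(WithLp.toLp 2 (a, b) : WithLp 2 (L2Circle × L2Circle))‖ ≤ ‖a‖ + ‖b‖ := by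
    rw [WithLp.prod_norm_eq_of_L2]
    exact Real.sqrt_le_iff.mpr
      ⟨by positivity, by simp; nlinarith [norm_nonneg a, norm_nonneg b]⟩
  rw [blockOp_apply]
  calc _ ≤ ‖A x.fst + B x.snd‖ + ‖C x.fst + D x.snd‖ := tri _ _
    _ ≤ (‖A‖ * ‖x‖ + ‖B‖ * ‖x‖) + (‖C‖ * ‖x‖ + ‖D‖ * ‖x‖) := by
      gcongr <;> refine norm_add_le_of_le ?_ ?_ <;> exact le_opNorm_of_le _ ‹_›
    _ = _ := by ring

end BlockOperators

section LoringElement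

theorem notMem_spectrum_half_of_norm_mul_self_sub_lt {A : Type*} [NormedRing A]
    [NormedAlgebra ℝ A] [CompleteSpace A] {e : A} (he : ‖e * e - e‖ < 1 / 4) :
    (1 / 2 : ℝ) ∉ spectrum ℝ e := by
  rw [spectrum.notMem_iff, ← isUnit_pow_iff two_ne_zero]
  have key : (algebraMap ℝ A (1 / 2) - e) ^ 2 =
      algebraMap ℝ A (1 / 4) * (1 - (-4 : ℝ) • (e * e - e)) := by
    simp only [Algebra.algebraMap_eq_smul_one, pow_two, sub_mul, mul_sub, smul_mul_assoc, one_mul,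
      mul_smul_comm, mul_one, smul_sub, smul_smul]
    module
  rw [key]
  refine IsUnit.mul ((isUnit_iff_ne_zero.mpr (by norm_num)).map (algebraMap ℝ A)) ?_
  refine isUnit_one_sub_of_norm_lt_one ?_
  rw [norm_smul]
  norm_num
  linarith

variable {F G H M : L2Circle →L[ℂ] L2Circle}

/-- The failure of a Loring element to be idempotent is controlled by the commutators of `M`
with the functional calculus. -/
theorem norm_blockOp_mul_self_sub_le {ε : ℝ} (hM : M ∈ unitary (L2Circle →L[ℂ] L2Circle))
    (hH : star H = H) (hF : star F = F)
    (hFG : F * G = G * F) (hFH : F * H = H * F) (hGH : G * H = 0) (hHG : H * G = 0)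
    (hsum : F * F + G * G + H * H = F) (hG1 : ‖G‖ ≤ 1) (hH1 : ‖H‖ ≤ 1)
    (hFM : ‖F * M - M * F‖ ≤ ε) (hHM : ‖H * M - M * H‖ ≤ ε) :
    ‖blockOp F (G + H * M) (star M * H + G) (1 - F) * blockOp F (G + H * M) (star M * H + G) (1 - F)
      - blockOp F (G + H * M) (star M * H + G) (1 - F)‖ ≤ 6 * ε := by
  have hε : 0 ≤ ε := (norm_nonneg _).trans hFM
  have hM1 := Unitary.mul_star_self_of_mem hM
  have hM2 := Unitary.star_mul_self_of_mem hM
  have star_comm {K : L2Circle →L[ℂ] L2Circle} (hK : star K = K) (h : ‖K * M - M * K‖ ≤ ε) :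
      ‖star M * K - K * star M‖ ≤ ε := by
    rw [← norm_star]
    simpa [hK] using h
  have e₁₁ : F * F + (G + H * M) * (star M * H + G) - F =
      G * (star M * H - H * star M) + (H * M - M * H) * G := by
    have : F * F + (G + H * M) * (star M * H + G) - F - (F * F + G * G + H * H - F) =
        G * star M * H + H * (M * star M) * H - H * H + H * M * G := by noncomm_ring
    rw [hsum, sub_self, sub_zero, hM1] at this
    rw [this, mul_sub, sub_mul, ← mul_assoc G H, hGH, mul_assoc M H G, hHG]
    noncomm_ring
  have e₁₂ : F * (G + H * M) + (G + H * M) * (1 - F) - (G + H * M) = H * (F * M - M * F) := by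
    have : F * (G + H * M) + (G + H * M) * (1 - F) - (G + H * M) =
      (F * G - G * F) + (F * H - H * F) * M + H * (F * M - M * F) := by noncomm_ring
    rw [this, hFG, hFH]
    simp
  have e₂₁ : (star M * H + G) * F + (1 - F) * (star M * H + G) - (star M * H + G) =
      (star M * F - F * star M) * H := by
    have : (star M * H + G) * F + (1 - F) * (star M * H + G) - (star M * H + G) =
      (G * F - F * G) + star M * (H * F - F * H) + (star M * F - F * star M) * H := by
      noncomm_ring
    rw [this, hFG, hFH]
    simp
  have e₂₂ : (star M * H + G) * (G + H * M) + (1 - F) * (1 - F) - (1 - F) =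
      star M * (H * (H * M - M * H) + (H * M - M * H) * H) := by
    have : (star M * H + G) * (G + H * M) + (1 - F) * (1 - F) - (1 - F)
        - (F * F + G * G + H * H - F) =
        star M * (H * G) + (G * H) * M + star M * H * H * M - H * H := by noncomm_ring
    rw [hsum, sub_self, sub_zero, hHG, hGH] at this
    have h' : star M * (H * (H * M - M * H) + (H * M - M * H) * H) =
        star M * H * H * M - (star M * M) * H * H := by noncomm_ring
    rw [this, h', hM2]
    simp
  have hMs : ‖star M‖ ≤ 1 := norm_le_one_of_mem_unitary (Unitary.star_mem hM)
  have b₁ := star_comm hH hHM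
  have b₂ := star_comm hF hFM
  rw [blockOp_mul, blockOp_sub, e₁₁, e₁₂, e₂₁, e₂₂]
  refine (norm_blockOp_le _ _ _ _).trans ?_
  have n₁₁ : ‖G * (star M * H - H * star M) + (H * M - M * H) * G‖ ≤ 1 * ε + ε * 1 :=
    norm_add_le_of_le (norm_mul_le_of_le hG1 b₁) (norm_mul_le_of_le hHM hG1)
  have n₁₂ : ‖H * (F * M - M * F)‖ ≤ 1 * ε := norm_mul_le_of_le hH1 hFM
  have n₂₁ : ‖(star M * F - F * star M) * H‖ ≤ ε * 1 := norm_mul_le_of_le b₂ hH1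
  have n₂₂ : ‖star M * (H * (H * M - M * H) + (H * M - M * H) * H)‖ ≤ 1 * (1 * ε + ε * 1) :=
    norm_mul_le_of_le hMs
      (norm_add_le_of_le (norm_mul_le_of_le hH1 hHM) (norm_mul_le_of_le hHM hH1))
  linarith

theorem norm_loringOp_mul_self_sub_le {f g h : ℂ → ℝ}
    (hf : ContinuousOn f (Metric.sphere (0 : ℂ) 1))
    (hg : ContinuousOn g (Metric.sphere (0 : ℂ) 1))
    (hh : ContinuousOn h (Metric.sphere (0 : ℂ) 1))
    (hrange : ∀ z : ℂ, ‖z‖ = 1 →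
      f z ∈ Set.Icc (0 : ℝ) 1 ∧ g z ∈ Set.Icc (0 : ℝ) 1 ∧ h z ∈ Set.Icc (0 : ℝ) 1)
    (hsum : ∀ z : ℂ, ‖z‖ = 1 → (f z) ^ 2 + (g z) ^ 2 + (h z) ^ 2 = f z)
    (hgh : ∀ z : ℂ, ‖z‖ = 1 → g z * h z = 0) {u : L2Circle →L[ℂ] L2Circle}
    (hu : u ∈ unitary (L2Circle →L[ℂ] L2Circle)) (hM : M ∈ unitary (L2Circle →L[ℂ] L2Circle))
    {ε : ℝ} (hfM : ‖cfc (fun z ↦ (f z : ℂ)) u * M - M * cfc (fun z ↦ (f z : ℂ)) u‖ ≤ ε)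
    (hhM : ‖cfc (fun z ↦ (h z : ℂ)) u * M - M * cfc (fun z ↦ (h z : ℂ)) u‖ ≤ ε) :
    ‖loringOp f g h u M * loringOp f g h u M - loringOp f g h u M‖ ≤ 6 * ε := by
  have hn : IsStarNormal u := isStarNormal_of_mem_unitary hu
  have hs {z : ℂ} (hz : z ∈ spectrum ℂ u) : ‖z‖ = 1 := by
    simpa using spectrum.subset_circle_of_unitary hu hz
  have cont {k : ℂ → ℝ} (hk : ContinuousOn k (Metric.sphere (0 : ℂ) 1)) :
      ContinuousOn (fun z ↦ (k z : ℂ)) (spectrum ℂ u) :=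
    Complex.continuous_ofReal.comp_continuousOn
      (hk.mono (spectrum.subset_circle_of_unitary hu))
  have cf := cont hf
  have cg := cont hg
  have ch := cont hh
  have selfAdj (k : ℂ → ℝ) : star (cfc (fun z ↦ (k z : ℂ)) u) = cfc (fun z ↦ (k z : ℂ)) u := by
    rw [← cfc_star]
    simp
  have norm_le {k : ℂ → ℝ} (hk : ∀ z : ℂ, ‖z‖ = 1 → k z ∈ Set.Icc (0 : ℝ) 1) :
      ‖cfc (fun z ↦ (k z : ℂ)) u‖ ≤ 1 := by
    refine norm_cfc_le zero_le_one fun z hz ↦ ?_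
    obtain ⟨h0, h1⟩ := hk z (hs hz)
    rwa [Complex.norm_real, Real.norm_of_nonneg h0]
  have hGH : cfc (fun z ↦ (g z : ℂ)) u * cfc (fun z ↦ (h z : ℂ)) u = 0 := by
    rw [← cfc_mul _ _ u cg ch, ← cfc_zero ℂ u]
    refine cfc_congr fun z hz ↦ ?_
    rw [Pi.zero_apply]
    exact_mod_cast hgh z (hs hz)
  refine norm_blockOp_mul_self_sub_le hM (selfAdj h) (selfAdj f) (cfc_commute_cfc _ _ u)
    (cfc_commute_cfc _ _ u) hGH ((cfc_commute_cfc _ _ u).eq.trans hGH) ?_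
    (norm_le fun z hz ↦ (hrange z hz).2.1) (norm_le fun z hz ↦ (hrange z hz).2.2) hfM hhM
  rw [← cfc_mul _ _ u cf cf, ← cfc_mul _ _ u cg cg, ← cfc_mul _ _ u ch ch,
    ← cfc_add u (fun z ↦ (f z : ℂ) * f z) (fun z ↦ (g z : ℂ) * g z) (cf.mul cf) (cg.mul cg),
    ← cfc_add u (fun z ↦ (f z : ℂ) * f z + g z * g z) (fun z ↦ (h z : ℂ) * h z)
      ((cf.mul cf).add (cg.mul cg)) (ch.mul ch)]
  refine cfc_congr fun z hz ↦ ?_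
  have := hsum z (hs hz)
  simp only [pow_two] at this
  exact_mod_cast this

end LoringElement

/-- For a continuous unimodular `v : S¹ → ℂ` there is `T ≥ 1` such that for all `t ≥ T`,
`1/2` is not in the spectrum of the self-adjoint operator `e(u_t, M_v)` on
`L²(S¹) ⊕ L²(S¹)`. -/
theorem loring_operator_spectrum_avoids_half
    (f g h : ℂ → ℝ)
    (hf : ContinuousOn f (Metric.sphere (0 : ℂ) 1))
    (hg : ContinuousOn g (Metric.sphere (0 : ℂ) 1))
    (hh : ContinuousOn h (Metric.sphere (0 : ℂ) 1))
    (hrange : ∀ z : ℂ, ‖z‖ = 1 →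
      f z ∈ Set.Icc (0 : ℝ) 1 ∧ g z ∈ Set.Icc (0 : ℝ) 1 ∧ h z ∈ Set.Icc (0 : ℝ) 1)
    (hsum : ∀ z : ℂ, ‖z‖ = 1 → (f z) ^ 2 + (g z) ^ 2 + (h z) ^ 2 = f z)
    (hgh : ∀ z : ℂ, ‖z‖ = 1 → g z * h z = 0)
    (hf1 : f 1 = 1) (hg1 : g 1 = 0) (hh1 : h 1 = 0)
    (v : AddCircle (1 : ℝ) → ℂ) (hv : Continuous v) (hv1 : ∀ x, ‖v x‖ = 1)
    (M : L2Circle →L[ℂ] L2Circle)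
    (hM : ∀ ξ : L2Circle, (⇑(M ξ)) =ᵐ[@haarAddCircle 1 _] fun x => v x * ξ x)
    (U : ℝ → (L2Circle →L[ℂ] L2Circle))
    (hU : ∀ t : ℝ, 1 ≤ t → ∀ n : ℤ,
      U t (fourierLp 2 n) =
        (if 0 ≤ n ∧ (n : ℝ) ≤ t then Complex.exp (2 * Real.pi * Complex.I * n / t) else 1) •
          fourierLp 2 n) :
    ∃ T : ℝ, 1 ≤ T ∧ ∀ t : ℝ, T ≤ t →
      (1 / 2 : ℝ) ∉ spectrum ℝ (loringOp f g h (U t) M) := by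
  set w : C(AddCircle (1 : ℝ), ℂ) := ⟨v, hv⟩
  obtain rfl : M = mulOp w := eq_mulOp_of_ae hM
  have hMu : mulOp w ∈ unitary (L2Circle →L[ℂ] L2Circle) := mulOp_mem_unitary hv1
  have hM1 : ‖mulOp w‖ ≤ 1 := norm_le_one_of_mem_unitary hMu
  have hε : (0 : ℝ) < 1 / 48 := by norm_num
  obtain ⟨δ₁, hδ₁, H₁⟩ := exists_commutator_cfc_le (A := L2Circle →L[ℂ] L2Circle)
    (Complex.continuous_ofReal.comp_continuousOn hf) hε
  obtain ⟨δ₂, hδ₂, H₂⟩ := exists_commutator_cfc_le (A := L2Circle →L[ℂ] L2Circle)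
    (Complex.continuous_ofReal.comp_continuousOn hh) hε
  obtain ⟨T, hT⟩ := eventually_atTop.mp
    (Metric.tendsto_nhds.mp (tendsto_commutator_mulOp hU w) (min δ₁ δ₂) (lt_min hδ₁ hδ₂))
  refine ⟨max T 1, le_max_right _ _, fun t ht ↦ ?_⟩
  have ht1 : 1 ≤ t := (le_max_right _ _).trans ht
  have hu := mem_unitary_of_diagEntry (by linarith) (hU t ht1)
  have hc := (hT t ((le_max_left _ _).trans ht)).le
  rw [dist_zero_right] at hc
  refine notMem_spectrum_half_of_norm_mul_self_sub_lt ?_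
  refine (norm_loringOp_mul_self_sub_le hf hg hh hrange hsum hgh hu hMu
    (H₁ _ hu _ hM1 (hc.trans (min_le_left _ _)))
    (H₂ _ hu _ hM1 (hc.trans (min_le_right _ _)))).trans_lt ?_
  norm_num
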